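/- For every integer m ≥ 0 and every real x > 0, G_8^{m−1}(x²) < V_m(x)/V_{m−1}(x) < G_4^m(x²), where G_k^m(y) = k y / ((k−1) y − m + √((y + m)² + k y)) and by convention V_{−1}(x) = 1/x. -/

import Mathlib

open MeasureTheory Real Set

/-- The one-dimensional regularized Coulomb potential `V_m(x)` for integer `m ≥ 0`. -/
noncomputable def V (m : ℕ) (x : ℝ) : ℝ :=
  (1 / (Nat.factorial m : ℝ)) *
    ∫ u in Set.Ioi (0:ℝ), u ^ m * Real.exp (-u) / Real.sqrt (x ^ 2 + u)

/-- `V_{m-1}(x)` with the convention `V_{-1}(x) = 1/x` (the case `m = 0`). -/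
noncomputable def Vpred (m : ℕ) (x : ℝ) : ℝ := if m = 0 then 1 / x else V (m - 1) x

/-- The comparison function `G_k^m(y) = ky / ((k-1)y - m + √((y+m)² + ky))`. -/
noncomputable def G (k m y : ℝ) : ℝ :=
  k * y / ((k - 1) * y - m + Real.sqrt ((y + m) ^ 2 + k * y))

/-- The integral `∫₀^∞ uᵐ e^{-u} / √(y + u) du` defining `m! V_m(√y)`. -/
noncomputable def coulombIntegral (m : ℕ) (y : ℝ) : ℝ :=
  ∫ u in Set.Ioi (0:ℝ), u ^ m * Real.exp (-u) / Real.sqrt (y + u)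

lemma V_sqrt (m : ℕ) {y : ℝ} (hy : 0 < y) :
    V m (√y) = (1 / (Nat.factorial m : ℝ)) * coulombIntegral m y := by
  simp only [V, coulombIntegral, Real.sq_sqrt hy.le]

lemma integrableOn_pow_mul_exp_neg (m : ℕ) :
    IntegrableOn (fun u : ℝ => u ^ m * Real.exp (-u)) (Ioi 0) := by
  have h := Real.GammaIntegral_convergent (s := (m : ℝ) + 1) (by positivity)
  refine h.congr_fun (fun u _ => ?_) measurableSet_Ioi
  simp [mul_comm]

lemma integral_pow_mul_exp_neg (m : ℕ) :
    ∫ u in Ioi (0:ℝ), u ^ m * Real.exp (-u) = (Nat.factorial m : ℝ) := by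
  rw [← Real.Gamma_nat_eq_factorial, Real.Gamma_eq_integral (by positivity)]
  refine setIntegral_congr_fun measurableSet_Ioi (fun u _ => ?_)
  simp [mul_comm]

lemma coulomb_integrand_le (m : ℕ) {y u : ℝ} (hy : 0 < y) (hu : 0 < u) :
    u ^ m * Real.exp (-u) / √(y + u) ≤ 1 / √y * (u ^ m * Real.exp (-u)) := by
  have h1 : √y ≤ √(y + u) := Real.sqrt_le_sqrt (by linarith)
  have h2 : 0 < √y := Real.sqrt_pos.2 hy
  rw [one_div, ← div_eq_inv_mul]
  gcongr

lemma integrableOn_coulomb (m : ℕ) {y : ℝ} (hy : 0 < y) :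
    IntegrableOn (fun u : ℝ => u ^ m * Real.exp (-u) / √(y + u)) (Ioi 0) := by
  refine Integrable.mono' ((integrableOn_pow_mul_exp_neg m).const_mul (1 / √y)) ?_ ?_
  · exact Measurable.aestronglyMeasurable (by fun_prop)
  · refine (ae_restrict_iff' measurableSet_Ioi).2 (Filter.Eventually.of_forall fun u hu => ?_)
    have hu' : 0 < u := hu
    rw [Real.norm_of_nonneg (by positivity)]
    exact coulomb_integrand_le m hy hu'

lemma coulombIntegral_pos (m : ℕ) {y : ℝ} (hy : 0 < y) : 0 < coulombIntegral m y := by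
  refine (setIntegral_pos_iff_support_of_nonneg_ae ?_ (integrableOn_coulomb m hy)).2 ?_
  · refine (ae_restrict_iff' measurableSet_Ioi).2 (Filter.Eventually.of_forall fun u hu => ?_)
    have hu' : 0 < u := hu
    simp only [Pi.zero_apply]
    positivity
  · have : Function.support (fun u : ℝ => u ^ m * Real.exp (-u) / √(y + u)) ∩ Ioi 0 = Ioi 0 := by
      refine inter_eq_right.2 fun u hu => ?_
      have hu' : 0 < u := hu
      have : 0 < u ^ m * Real.exp (-u) / √(y + u) := by positivity
      exact this.ne'
    rw [this]
    simp

lemma coulombIntegral_le (m : ℕ) {y : ℝ} (hy : 0 < y) :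
    coulombIntegral m y ≤ 1 / √y * (Nat.factorial m : ℝ) := by
  rw [← integral_pow_mul_exp_neg, ← integral_const_mul]
  exact setIntegral_mono_on (integrableOn_coulomb m hy)
    ((integrableOn_pow_mul_exp_neg m).const_mul (1 / √y)) measurableSet_Ioi
    fun u hu => coulomb_integrand_le m hy hu

lemma tendsto_pow_mul_exp_neg_mul_sqrt (m : ℕ) {y : ℝ} (hy : 0 < y) :
    Filter.Tendsto (fun u : ℝ => u ^ m * Real.exp (-u) * √(y + u)) Filter.atTop (nhds 0) := by
  have h1 := (Real.tendsto_pow_mul_exp_neg_atTop_nhds_zero m).mul_const (y + 1)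
  have h2 := h1.add (Real.tendsto_pow_mul_exp_neg_atTop_nhds_zero (m + 1))
  rw [zero_mul, zero_add] at h2
  refine squeeze_zero' ?_ ?_ h2
  · filter_upwards [Filter.eventually_gt_atTop 0] with u hu
    positivity
  · filter_upwards [Filter.eventually_gt_atTop 0] with u hu
    have h3 : √(y + u) ≤ y + 1 + u := by
      rw [Real.sqrt_le_left (by linarith)]
      nlinarith
    calc u ^ m * Real.exp (-u) * √(y + u) ≤ u ^ m * Real.exp (-u) * (y + 1 + u) := by gcongr
      _ = _ := by ring

lemma coulombIntegral_recurrence (m : ℕ) {y : ℝ} (hy : 0 < y) :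
    coulombIntegral (m + 1) y = (m + 1 / 2 - y) * coulombIntegral m y
      + m * y * coulombIntegral (m - 1) y + 0 ^ m * √y := by
  set g : ℕ → ℝ → ℝ := fun n u => u ^ n * Real.exp (-u) / √(y + u) with hg
  have hgi : ∀ n, IntegrableOn (g n) (Ioi 0) := fun n => integrableOn_coulomb n hy
  have hderiv : ∀ u ∈ Ici (0:ℝ), HasDerivAt (fun u : ℝ => u ^ m * Real.exp (-u) * √(y + u))
      ((m + 1 / 2 - y) * g m u + m * y * g (m - 1) u - g (m + 1) u) u := by
    intro u hu
    have hu' : 0 ≤ u := hu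
    have hpos : 0 < y + u := by linarith
    have hs : 0 < √(y + u) := Real.sqrt_pos.2 hpos
    have hss : √(y + u) ^ 2 = y + u := Real.sq_sqrt hpos.le
    have hd1 := hasDerivAt_pow m u
    have hd2 := (hasDerivAt_neg u).exp
    have hd3 := ((hasDerivAt_id u).const_add y).sqrt hpos.ne'
    refine ((hd1.mul hd2).mul hd3).congr_deriv ?_
    simp only [hg, id]
    rcases m with _ | n
    · field_simp
      simp only [hss, Pi.mul_apply]
      push_cast
      ring
    · field_simp
      simp only [hss, Nat.add_sub_cancel, Pi.mul_apply]
      push_cast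
      ring
  have hsum : IntegrableOn (fun u => (m + 1 / 2 - y) * g m u + m * y * g (m - 1) u) (Ioi 0) :=
    ((hgi m).const_mul _).add ((hgi (m - 1)).const_mul _)
  have h := integral_Ioi_of_hasDerivAt_of_tendsto' hderiv (hsum.sub (hgi (m + 1)))
    (tendsto_pow_mul_exp_neg_mul_sqrt m hy)
  rw [integral_sub hsum (hgi (m + 1)),
    integral_add ((hgi m).const_mul _) ((hgi (m - 1)).const_mul _), integral_const_mul,
    integral_const_mul] at h
  simp only [neg_zero, Real.exp_zero, add_zero, mul_one] at h
  simp only [coulombIntegral]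
  linarith

lemma coulombIntegral_zero_eq (y : ℝ) :
    coulombIntegral 0 y = Real.exp y * ∫ t in Ioi y, Real.exp (-t) / √t := by
  have h := (measurePreserving_add_right volume y).setIntegral_preimage_emb
    (measurableEmbedding_addRight y) (fun t => Real.exp (-t) / √t) (Ioi y)
  rw [preimage_add_const_Ioi, sub_self] at h
  rw [← h, ← integral_const_mul, coulombIntegral]
  refine setIntegral_congr_fun measurableSet_Ioi (fun u _ => ?_)
  have : Real.exp (-u) = Real.exp y * Real.exp (-(u + y)) := by
    rw [← Real.exp_add]; ring_nf
  simp only [pow_zero, one_mul]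
  rw [this, add_comm y u, mul_div_assoc]

lemma hasDerivAt_coulombIntegral_zero {y : ℝ} (hy : 0 < y) :
    HasDerivAt (coulombIntegral 0) (coulombIntegral 0 y - 1 / √y) y := by
  set f : ℝ → ℝ := fun t => Real.exp (-t) / √t with hf
  have hcont : ContinuousOn f (Ioi 0) := by
    refine ContinuousOn.div (by fun_prop) (by fun_prop) fun t ht => (Real.sqrt_pos.2 ht).ne'
  have hfi : ∀ z > 0, IntegrableOn f (Ioi z) := by
    intro z hz
    have h : IntegrableOn (fun t : ℝ => 1 / √z * (t ^ 0 * Real.exp (-t))) (Ioi z) :=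
      ((integrableOn_pow_mul_exp_neg 0).mono_set (Ioi_subset_Ioi hz.le)).const_mul (1 / √z)
    refine Integrable.mono' h (Measurable.aestronglyMeasurable (by fun_prop)) ?_
    refine (ae_restrict_iff' measurableSet_Ioi).2 (Filter.Eventually.of_forall fun t ht => ?_)
    have htz : z < t := ht
    have hzt : √z ≤ √t := Real.sqrt_le_sqrt htz.le
    have hs : 0 < √z := Real.sqrt_pos.2 hz
    rw [Real.norm_of_nonneg (by positivity), pow_zero, one_mul, one_div, ← div_eq_inv_mul]
    exact div_le_div_of_nonneg_left (Real.exp_pos _).le hs hzt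
  have hF : HasDerivAt (fun z => ∫ t in Ioi z, f t) (-f y) y := by
    have hii : ∀ z > 0, IntervalIntegrable f volume y z := fun z hz =>
      (hcont.mono ((convex_Ioi (0:ℝ)).ordConnected.uIcc_subset hy hz)).intervalIntegrable
    have h1 : HasDerivAt (fun z => ∫ t in y..z, f t) (f y) y :=
      intervalIntegral.integral_hasDerivAt_right (hii y hy)
        (hcont.stronglyMeasurableAtFilter isOpen_Ioi y hy) (hcont.continuousAt (Ioi_mem_nhds hy))
    refine (h1.const_sub (∫ t in Ioi y, f t)).congr_of_eventuallyEq ?_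
    filter_upwards [Ioi_mem_nhds hy] with z hz
    have := intervalIntegral.integral_interval_add_Ioi (hfi y hy) (hfi z hz)
    linarith
  have hE := (Real.hasDerivAt_exp y).mul hF
  refine (hE.congr_of_eventuallyEq ?_).congr_deriv ?_
  · exact Filter.Eventually.of_forall coulombIntegral_zero_eq
  · rw [coulombIntegral_zero_eq y, hf]
    have : Real.exp y * Real.exp (-y) = 1 := by rw [← Real.exp_add]; simp
    simp only [sub_eq_add_neg, mul_neg, ← mul_div_assoc, this]

lemma V_sqrt_pos (m : ℕ) {y : ℝ} (hy : 0 < y) : 0 < V m (√y) := by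
  rw [V_sqrt m hy]
  have := coulombIntegral_pos m hy
  positivity

lemma V_sqrt_le (m : ℕ) {y : ℝ} (hy : 0 < y) : V m (√y) ≤ 1 / √y := by
  rw [V_sqrt m hy]
  have h := coulombIntegral_le m hy
  have hm : (0:ℝ) < Nat.factorial m := by positivity
  rw [one_div_mul_eq_div, div_le_iff₀ hm]
  exact h

lemma Vpred_sqrt_pos (m : ℕ) {y : ℝ} (hy : 0 < y) : 0 < Vpred m (√y) := by
  rcases m with _ | n
  · simpa [Vpred] using hy
  · simpa [Vpred] using V_sqrt_pos n hy

lemma Vpred_sqrt_le (m : ℕ) {y : ℝ} (hy : 0 < y) : Vpred m (√y) ≤ 1 / √y := by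
  rcases m with _ | n
  · simp [Vpred]
  · simpa [Vpred] using V_sqrt_le n hy

lemma V_sqrt_recurrence (m : ℕ) {y : ℝ} (hy : 0 < y) :
    V (m + 1) (√y) = ((m + 1 / 2 - y) * V m (√y) + y * Vpred m (√y)) / (m + 1) := by
  rw [V_sqrt _ hy, V_sqrt _ hy, coulombIntegral_recurrence m hy]
  rcases m with _ | n
  · have : y * (√y)⁻¹ = √y := by
      rw [← div_eq_mul_inv, Real.div_sqrt]
    simp [Vpred, this]
  · have h1 : (Nat.factorial n : ℝ) ≠ 0 := by positivity
    simp only [Vpred, Nat.add_eq_zero_iff, one_ne_zero, and_false, if_false, Nat.add_sub_cancel,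
      V_sqrt n hy, Nat.factorial_succ]
    push_cast
    field_simp
    ring

lemma hasDerivAt_V_Vpred_sqrt (m : ℕ) : ∀ y : ℝ, 0 < y →
    HasDerivAt (fun z => V m (√z)) (V m (√y) - Vpred m (√y)) y ∧
    HasDerivAt (fun z => Vpred m (√z))
      (((m - 1 / 2) * Vpred m (√y) - m * V m (√y)) / y) y := by
  induction m with
  | zero =>
    intro y hy
    have hs : 0 < √y := Real.sqrt_pos.2 hy
    constructor
    · refine ((hasDerivAt_coulombIntegral_zero hy).congr_of_eventuallyEq ?_).congr_deriv ?_
      · filter_upwards [Ioi_mem_nhds hy] with z hz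
        simp [V_sqrt 0 hz]
      · simp [V_sqrt 0 hy, Vpred]
    · have h := ((hasDerivAt_id y).sqrt hy.ne').inv hs.ne'
      have hss : √y ^ 2 = y := Real.sq_sqrt hy.le
      simp only [Vpred, if_true, one_div]
      refine h.congr_deriv ?_
      simp only [id, hss]
      push_cast
      field_simp
      ring
  | succ n ih =>
    intro y hy
    obtain ⟨h1, h2⟩ := ih y hy
    have hn : (n : ℝ) + 1 ≠ 0 := by positivity
    have hrec := V_sqrt_recurrence n hy
    have hP : ∀ z, Vpred (n + 1) z = V n z := fun z => by simp [Vpred]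
    simp only [hP]
    constructor
    · have h3 := ((((hasDerivAt_id y).const_sub ((n:ℝ) + 1 / 2)).mul h1).add
        ((hasDerivAt_id y).mul h2)).div_const ((n:ℝ) + 1)
      refine (h3.congr_of_eventuallyEq ?_).congr_deriv ?_
      · filter_upwards [Ioi_mem_nhds hy] with z hz
        simpa using V_sqrt_recurrence n hz
      · rw [hrec]
        simp only [id]
        field_simp
        ring
    · refine h1.congr_deriv ?_
      rw [hrec]
      push_cast
      field_simp
      ring

/-- A bounded strict subsolution of `H' = c H` on `(0, ∞)` with `c` bounded below at infinity
is negative. -/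
lemma neg_of_mul_lt_deriv {H H' c : ℝ → ℝ} {B : ℝ}
    (hH : ∀ y > 0, HasDerivAt H (H' y) y) (hc : ContinuousOn c (Ioi 0))
    (hlt : ∀ y > 0, c y * H y < H' y) (hc1 : ∀ y ≥ 1, 1 / 2 ≤ c y)
    (hB : ∀ y ≥ 1, |H y| ≤ B) : ∀ y > 0, H y < 0 := by
  set P : ℝ → ℝ := fun y => ∫ t in (1:ℝ)..y, c t with hPdef
  have hii : ∀ z > 0, IntervalIntegrable c volume 1 z := fun z hz =>
    (hc.mono ((convex_Ioi (0:ℝ)).ordConnected.uIcc_subset (mem_Ioi.2 one_pos) hz)).intervalIntegrable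
  have hP : ∀ y > 0, HasDerivAt P (c y) y := fun y hy =>
    intervalIntegral.integral_hasDerivAt_right (hii y hy)
      (hc.stronglyMeasurableAtFilter isOpen_Ioi y hy) (hc.continuousAt (Ioi_mem_nhds hy))
  have hE : ∀ y > 0, HasDerivAt (fun y => H y * Real.exp (-P y))
      ((H' y - c y * H y) * Real.exp (-P y)) y := fun y hy =>
    ((hH y hy).mul (hP y hy).neg.exp).congr_deriv (by simp only [Pi.neg_apply]; ring)
  have hmono : StrictMonoOn (fun y => H y * Real.exp (-P y)) (Ioi 0) := by
    refine strictMonoOn_of_deriv_pos (convex_Ioi 0)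
      (fun y hy => (hE y hy).continuousAt.continuousWithinAt) fun y hy => ?_
    rw [interior_Ioi] at hy
    rw [(hE y hy).deriv]
    exact mul_pos (sub_pos.2 (hlt y hy)) (Real.exp_pos _)
  have hPge : ∀ y ≥ 1, (y - 1) / 2 ≤ P y := by
    intro y hy
    have h := intervalIntegral.integral_mono_on (μ := volume) (f := fun _ => (1 / 2 : ℝ)) hy
      intervalIntegrable_const (hii y (by linarith)) fun t ht => hc1 t ht.1
    rw [intervalIntegral.integral_const, smul_eq_mul] at h
    linarith
  have hlim : Filter.Tendsto (fun y => H y * Real.exp (-P y)) Filter.atTop (nhds 0) := by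
    have h0 : Filter.Tendsto (fun y : ℝ => B * Real.exp (-((y - 1) / 2))) Filter.atTop
        (nhds 0) := by
      have : Filter.Tendsto (fun y : ℝ => (y - 1) / 2) Filter.atTop Filter.atTop :=
        (Filter.tendsto_atTop_add_const_right _ (-1) Filter.tendsto_id).atTop_div_const
          (by norm_num)
      simpa using (Real.tendsto_exp_neg_atTop_nhds_zero.comp this).const_mul B
    refine squeeze_zero_norm' ?_ h0
    filter_upwards [Filter.eventually_ge_atTop 1] with y hy
    rw [norm_mul, Real.norm_eq_abs, Real.norm_of_nonneg (Real.exp_pos _).le]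
    have h1 := hB y hy
    have h2 := hPge y hy
    have h3 : 0 ≤ B := (abs_nonneg _).trans h1
    gcongr
  intro y hy
  have hy1 : y + 1 ∈ Ioi (0:ℝ) := by simp only [mem_Ioi]; linarith
  have hle : H (y + 1) * Real.exp (-P (y + 1)) ≤ 0 := by
    refine ge_of_tendsto hlim ?_
    filter_upwards [Filter.eventually_ge_atTop (y + 1)] with z hz
    exact hmono.monotoneOn hy1 (lt_of_lt_of_le hy1 hz) hz
  have hlt' : H y * Real.exp (-P y) < 0 := (hmono hy hy1 (by linarith)).trans_le hle
  exact neg_of_mul_neg_left hlt' (Real.exp_pos _).le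

/-- The reciprocal of `G`. -/
noncomputable def Ginv (k p y : ℝ) : ℝ :=
  ((k - 1) * y - p + √((y + p) ^ 2 + k * y)) / (k * y)

lemma G_eq_inv (k p y : ℝ) : G k p y = (Ginv k p y)⁻¹ := by
  rw [G, Ginv, inv_div]

lemma one_le_Ginv {k p y : ℝ} (hk : 0 < k) (hy : 0 < y) : 1 ≤ Ginv k p y := by
  rw [Ginv, le_div_iff₀ (by positivity)]
  have : y + p ≤ √((y + p) ^ 2 + k * y) := Real.le_sqrt_of_sq_le (by nlinarith [mul_pos hk hy])
  linarith

lemma Ginv_le_two {k p y : ℝ} (hk : 1 ≤ k) (hp : -1 ≤ p) (hy : 1 ≤ y) : Ginv k p y ≤ 2 := by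
  rw [Ginv, div_le_iff₀ (by positivity)]
  have : √((y + p) ^ 2 + k * y) ≤ y + p + k := by
    rw [Real.sqrt_le_left (by linarith)]
    nlinarith
  nlinarith

lemma hasDerivAt_Ginv {k p y : ℝ} (hk : 0 < k) (hy : 0 < y) :
    HasDerivAt (Ginv k p) (((y + p + k / 2) / √((y + p) ^ 2 + k * y)
      - (√((y + p) ^ 2 + k * y) - p) / y) / (k * y)) y := by
  have hpos : 0 < (y + p) ^ 2 + k * y := by positivity
  have hs := Real.sqrt_pos.2 hpos
  have h1 := ((((hasDerivAt_id y).add_const p).pow 2).add ((hasDerivAt_id y).const_mul k)).sqrt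
    hpos.ne'
  have h2 := ((((hasDerivAt_id y).const_mul (k - 1)).sub_const p).add h1).div
    ((hasDerivAt_id y).const_mul k) (mul_pos hk hy).ne'
  refine h2.congr_deriv ?_
  simp
  field_simp
  ring

/-- If `Ginv k p` is a strict supersolution of the Riccati equation
`y T' = y T² - (y + 1/2 - m) T - m` satisfied by `V_{m-1}/V_m`, it bounds it from below
(and symmetrically for subsolutions); here `ε = ± 1` selects the direction. -/
lemma Ginv_mul_V_sub_Vpred_neg (m : ℕ) {k p ε : ℝ} (hk : 1 ≤ k) (hp : -1 ≤ p) (hε : |ε| = 1)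
    (hS : ∀ y > 0, 0 < ε * (((y + p + k / 2) / √((y + p) ^ 2 + k * y)
      - (√((y + p) ^ 2 + k * y) - p) / y) / k - y * Ginv k p y ^ 2
      + (y + 1 / 2 - m) * Ginv k p y + m)) {y : ℝ} (hy : 0 < y) :
    ε * (Ginv k p y * V m (√y) - Vpred m (√y)) < 0 := by
  have hk0 : 0 < k := by linarith
  refine neg_of_mul_lt_deriv (H := fun y => ε * (Ginv k p y * V m (√y) - Vpred m (√y)))
    (c := fun y => Ginv k p y + (m - 1 / 2) / y) (B := 3)
    (fun y hy => (((hasDerivAt_Ginv hk0 hy).mul (hasDerivAt_V_Vpred_sqrt m y hy).1).sub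
      (hasDerivAt_V_Vpred_sqrt m y hy).2).const_mul ε) ?_ ?_ ?_ ?_ y hy
  · refine ContinuousOn.add
      (fun y hy => (hasDerivAt_Ginv hk0 hy).continuousAt.continuousWithinAt) ?_
    exact ContinuousOn.div continuousOn_const continuousOn_id fun y hy => ne_of_gt hy
  · intro y hy
    rw [← sub_pos]
    have h := mul_pos (hS y hy) (div_pos (V_sqrt_pos m hy) hy)
    refine h.trans_eq ?_
    generalize √((y + p) ^ 2 + k * y) = s
    generalize Ginv k p y = T
    generalize V m (√y) = v
    generalize Vpred m (√y) = w
    have hk' := hk0.ne'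
    field_simp
    ring
  · intro y hy
    have hy0 : 0 < y := by linarith
    have h1 : 1 ≤ Ginv k p y := one_le_Ginv hk0 hy0
    have h2 : -(1 / 2) ≤ ((m:ℝ) - 1 / 2) / y := by
      rw [le_div_iff₀ hy0]
      have : (0:ℝ) ≤ m := by positivity
      linarith
    linarith
  · intro y hy
    have hy0 : 0 < y := by linarith
    rw [abs_mul, hε, one_mul, abs_le]
    have h1 : 1 ≤ Ginv k p y := one_le_Ginv hk0 hy0
    have h2 := Ginv_le_two hk hp hy
    have h3 := V_sqrt_pos m hy0
    have h4 := Vpred_sqrt_pos m hy0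
    have h5 : 1 / √y ≤ 1 := by
      rw [div_le_one (Real.sqrt_pos.2 hy0)]
      exact Real.one_le_sqrt.2 hy
    have h6 := (V_sqrt_le m hy0).trans h5
    have h7 := (Vpred_sqrt_le m hy0).trans h5
    constructor <;> nlinarith

lemma Ginv_four_supersolution {m y : ℝ} (hm : 0 ≤ m) (hy : 0 < y) :
    0 < ((y + m + 4 / 2) / √((y + m) ^ 2 + 4 * y)
      - (√((y + m) ^ 2 + 4 * y) - m) / y) / 4 - y * Ginv 4 m y ^ 2
      + (y + 1 / 2 - m) * Ginv 4 m y + m := by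
  have hpos : 0 < (y + m) ^ 2 + 4 * y := by positivity
  have hs := Real.sqrt_pos.2 hpos
  have hss := Real.sq_sqrt hpos.le
  have hlt : √((y + m) ^ 2 + 4 * y) < y + m + 2 := by
    rw [Real.sqrt_lt' (by positivity)]
    nlinarith
  rw [Ginv]
  generalize √((y + m) ^ 2 + 4 * y) = s at *
  have hsz : 0 < s - (y + m) := by nlinarith
  have key : ((y + m + 4 / 2) / s - (s - m) / y) / 4 - y * (((4 - 1) * y - m + s) / (4 * y)) ^ 2
      + (y + 1 / 2 - m) * (((4 - 1) * y - m + s) / (4 * y)) + m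
      = (s - (y + m)) * (y + m) * (y + m + 2 - s) / (16 * y * s) := by
    field_simp
    grind
  rw [key]
  have : 0 < y + m + 2 - s := by linarith
  positivity

lemma Ginv_eight_subsolution {m y : ℝ} (hm : 0 ≤ m) (hy : 0 < y) :
    ((y + (m - 1) + 8 / 2) / √((y + (m - 1)) ^ 2 + 8 * y)
      - (√((y + (m - 1)) ^ 2 + 8 * y) - (m - 1)) / y) / 8 - y * Ginv 8 (m - 1) y ^ 2
      + (y + 1 / 2 - m) * Ginv 8 (m - 1) y + m < 0 := by
  have hpos : 0 < (y + (m - 1)) ^ 2 + 8 * y := by positivity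
  have hs := Real.sqrt_pos.2 hpos
  have hss := Real.sq_sqrt hpos.le
  have hlt : √((y + (m - 1)) ^ 2 + 8 * y) < y + (m - 1) + 4 := by
    rw [Real.sqrt_lt' (by linarith)]
    nlinarith
  rw [Ginv]
  generalize √((y + (m - 1)) ^ 2 + 8 * y) = s at *
  have hsz : 0 < s - (y + (m - 1)) := by nlinarith
  have key : ((y + (m - 1) + 8 / 2) / s - (s - (m - 1)) / y) / 8
      - y * (((8 - 1) * y - (m - 1) + s) / (8 * y)) ^ 2
      + (y + 1 / 2 - m) * (((8 - 1) * y - (m - 1) + s) / (8 * y)) + m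
      = -((s - (y + (m - 1))) * (2 * s - (y + (m - 1))) * (y + (m - 1) + 4 - s) / (64 * y * s)) := by
    field_simp
    grind
  rw [key, neg_lt_zero]
  have h1 : 0 < y + (m - 1) + 4 - s := by linarith
  have h2 : 0 < 2 * s - (y + (m - 1)) := by linarith
  positivity

theorem V_ratio_bounds (m : ℕ) (x : ℝ) (hx : 0 < x) :
    G 8 ((m : ℝ) - 1) (x ^ 2) < V m x / Vpred m x ∧
    V m x / Vpred m x < G 4 (m : ℝ) (x ^ 2) := by
  have hy : 0 < x ^ 2 := by positivity
  have hm : (0:ℝ) ≤ m := by positivity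
  have hupper := Ginv_mul_V_sub_Vpred_neg m (k := 4) (p := m) (ε := 1) (by norm_num)
    (by linarith) (by simp) (fun y hy => by simpa using Ginv_four_supersolution hm hy) hy
  have hlower := Ginv_mul_V_sub_Vpred_neg m (k := 8) (p := m - 1) (ε := -1) (by norm_num)
    (by linarith) (by simp)
    (fun y hy => by rw [neg_one_mul, neg_pos]; exact Ginv_eight_subsolution hm hy) hy
  have hP := Vpred_sqrt_pos m hy
  rw [Real.sqrt_sq hx.le] at hupper hlower hP
  have hT4 : 0 < Ginv 4 m (x ^ 2) := one_pos.trans_le (one_le_Ginv (by norm_num) hy)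
  have hT8 : 0 < Ginv 8 (m - 1) (x ^ 2) := one_pos.trans_le (one_le_Ginv (by norm_num) hy)
  rw [G_eq_inv, G_eq_inv]
  constructor
  · rw [lt_div_iff₀ hP, inv_mul_lt_iff₀ hT8]
    linarith
  · rw [div_lt_iff₀ hP, lt_inv_mul_iff₀ hT4]
    linarith
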